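/- Let Y be square-integrable and non-degenerate and let (Y,Y') be the Markov product of (X,Y). Then 𝔼[Y|X] = 𝔼[Y] almost surely if and only if Y and Y' are uncorrelated, i.e. Cov(Y,Y') = 0. -/

import Mathlib

open MeasureTheory ProbabilityTheory Set

/-- `Y'` is a conditionally independent copy of `Y` given `X`:
the conditional distribution of `Y'` given `X = x` equals the conditional distribution of `Y`
given `X = x` for `ℙ^X`-almost all `x`, and `Y` and `Y'` are conditionally independent
given `X`.  The pair `(Y, Y')` is then called the Markov product of `(X, Y)`. -/
def IsCondIndepCopy {Ω E : Type*} [MeasurableSpace Ω] [StandardBorelSpace Ω] [Nonempty Ω]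
    [MeasurableSpace E] (μ : Measure Ω) [IsFiniteMeasure μ]
    (X : Ω → E) (hX : Measurable X) (Y Y' : Ω → ℝ) : Prop :=
  (∀ᵐ x ∂(μ.map X), condDistrib Y' X μ x = condDistrib Y X μ x) ∧
  CondIndepFun (MeasurableSpace.comap X inferInstance) hX.comap_le Y Y' μ

/-- Conditionally independent random variables are almost surely independent under the
conditional expectation kernel. -/
lemma CondIndepFun.ae_indepFun_condExpKernel {Ω : Type*} {m mΩ : MeasurableSpace Ω}
    [StandardBorelSpace Ω] {hm : m ≤ mΩ} {μ : Measure Ω} [IsFiniteMeasure μ]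
    {f g : Ω → ℝ} (hf : Measurable f) (hg : Measurable g) (h : CondIndepFun m hm f g μ) :
    ∀ᵐ ω ∂μ, IndepFun f g (condExpKernel μ m ω) := by
  filter_upwards [ae_of_ae_trim hm ((condIndepFun_iff_map_prod_eq_prod_map_map hf hg).1 h)]
    with ω hω
  rw [Kernel.map_apply _ (by fun_prop), Kernel.prod_apply, Kernel.map_apply _ hf,
    Kernel.map_apply _ hg] at hω
  exact (indepFun_iff_map_prod_eq_prod_map_map hf.aemeasurable hg.aemeasurable).2 hω

/-- The conditional expectation of a product of conditionally independent random variables is the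
product of the conditional expectations. -/
lemma CondIndepFun.condExp_mul_ae_eq {Ω : Type*} {m mΩ : MeasurableSpace Ω}
    [StandardBorelSpace Ω] {hm : m ≤ mΩ} {μ : Measure Ω} [IsFiniteMeasure μ]
    {f g : Ω → ℝ} (hf : Measurable f) (hg : Measurable g) (hf_int : Integrable f μ)
    (hg_int : Integrable g μ) (hfg_int : Integrable (fun ω ↦ f ω * g ω) μ)
    (h : CondIndepFun m hm f g μ) :
    μ[fun ω ↦ f ω * g ω | m] =ᵐ[μ] fun ω ↦ (μ[f | m]) ω * (μ[g | m]) ω := by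
  filter_upwards [CondIndepFun.ae_indepFun_condExpKernel hf hg h,
    condExp_ae_eq_integral_condExpKernel hm hf_int,
    condExp_ae_eq_integral_condExpKernel hm hg_int,
    condExp_ae_eq_integral_condExpKernel hm hfg_int] with ω hω hfω hgω hfgω
  rw [hfω, hgω, hfgω]
  exact hω.integral_fun_mul_eq_mul_integral hf.aestronglyMeasurable hg.aestronglyMeasurable

/-- Random variables with the same conditional distribution given `X` are identically
distributed. -/
lemma identDistrib_of_condDistrib_ae_eq {Ω E : Type*} [MeasurableSpace Ω] [MeasurableSpace E]
    {μ : Measure Ω} [IsFiniteMeasure μ] {X : Ω → E} {Y Y' : Ω → ℝ} (hX : Measurable X)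
    (hY : Measurable Y) (hY' : Measurable Y')
    (h : ∀ᵐ x ∂(μ.map X), condDistrib Y' X μ x = condDistrib Y X μ x) :
    IdentDistrib Y Y' μ μ where
  aemeasurable_fst := hY.aemeasurable
  aemeasurable_snd := hY'.aemeasurable
  map_eq := by
    rw [← condDistrib_comp_map hX.aemeasurable hY.aemeasurable,
      ← condDistrib_comp_map hX.aemeasurable hY'.aemeasurable]
    exact Measure.bind_congr_right (h.mono fun _ hx ↦ hx.symm)

/-- For square-integrable, non-degenerate `Y` and the Markov product `(Y, Y')` of `(X, Y)`:
`𝔼[Y∣X] = 𝔼[Y]` almost surely (zero-explainability) if and only if `Y` and `Y'` are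
uncorrelated, i.e. `Cov(Y, Y') = 0`. -/
theorem zero_explainability_iff_uncorrelated {Ω : Type*} [MeasurableSpace Ω]
    [StandardBorelSpace Ω] [Nonempty Ω] {p : ℕ} (μ : Measure Ω) [IsProbabilityMeasure μ]
    (X : Ω → (Fin p → ℝ)) (Y Y' : Ω → ℝ)
    (hX : Measurable X) (hY : Measurable Y) (hY' : Measurable Y')
    (hL2 : MemLp Y 2 μ)
    (hnondeg : ¬ ∃ c : ℝ, Y =ᵐ[μ] fun _ => c)
    (hcopy : IsCondIndepCopy μ X hX Y Y') :
    (μ[Y | MeasurableSpace.comap X inferInstance] =ᵐ[μ] fun _ => ∫ ω, Y ω ∂μ)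
      ↔ (∫ ω, Y ω * Y' ω ∂μ) - (∫ ω, Y ω ∂μ) * (∫ ω, Y' ω ∂μ) = 0 := by
  obtain ⟨hdistrib, hindep⟩ := hcopy
  have hident := identDistrib_of_condDistrib_ae_eq hX hY hY' hdistrib
  have hL2' : MemLp Y' 2 μ := hident.memLp_iff.1 hL2
  have hint : Integrable Y μ := hL2.integrable one_le_two
  have hint' : Integrable Y' μ := hL2'.integrable one_le_two
  have hcond : μ[Y' | MeasurableSpace.comap X inferInstance] =ᵐ[μ]
      μ[Y | MeasurableSpace.comap X inferInstance] := by
    filter_upwards [condExp_ae_eq_integral_condDistrib' hX hint,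
      condExp_ae_eq_integral_condDistrib' hX hint', ae_of_ae_map hX.aemeasurable hdistrib]
      with ω h h' hd
    rw [h, h', hd]
  have hprod : ∫ ω, Y ω * Y' ω ∂μ =
      ∫ ω, (μ[Y | MeasurableSpace.comap X inferInstance]) ω ^ 2 ∂μ := by
    rw [← integral_condExp hX.comap_le]
    refine integral_congr_ae ?_
    filter_upwards [CondIndepFun.condExp_mul_ae_eq hY hY' hint hint'
      (hL2.integrable_mul hL2') hindep, hcond] with ω h h'
    rw [h, h', sq]
  have hcond_mean : ∫ ω, (μ[Y | MeasurableSpace.comap X inferInstance]) ω ∂μ = ∫ ω, Y ω ∂μ :=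
    integral_condExp hX.comap_le
  have hcondL2 : MemLp (μ[Y | MeasurableSpace.comap X inferInstance]) 2 μ :=
    hL2.condExp one_le_two
  have hcov : (∫ ω, Y ω * Y' ω ∂μ) - (∫ ω, Y ω ∂μ) * (∫ ω, Y' ω ∂μ) =
      Var[μ[Y | MeasurableSpace.comap X inferInstance]; μ] := by
    rw [variance_eq_sub hcondL2, hcond_mean, ← hident.integral_eq, hprod, sq (∫ ω, Y ω ∂μ)]
    rfl
  rw [hcov]
  constructor
  · intro h
    rw [variance_congr h]
    simp [variance_eq_integral aemeasurable_const]
  · intro h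
    rw [← hcond_mean]
    exact ae_eq_integral_of_variance_eq_zero hcondL2 h
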